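/- arXiv:1203.0922 — 2 statements merged into one kernel-verified Lean document; each statement's English description precedes it below -/
import Mathlib

section
/- For every n ≥ 2, the identity (n+1)·Σ t^{des(w)+1}(1+t)^{n−2−2·des(w)} = (−1)^n(n+1) + Σ_{r=0}^{n−1} (−1)^r C(n+1,r)·Σ_{k=0}^{n−1−r} C(n−1−r,k)·Σ_{w ∈ [n+1]^{n−r−k}} t^{des(w)+k} holds in ℤ[t], where the left-hand sum is over all parking functions w of length n that have no double descent and satisfy w₁ ≤ w₂ and w_{n−1} ≤ w_n. This is the combinatorial identity underlying the formula for the top Betti number of NC_{n+1}^− ∗ T_{t,n−1}. -/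
attribute [local instance] Classical.propDecidable

open Polynomial

/-- The number of descents of the word `w = w₁ ⋯ w_m`:
indices `i ∈ [m-1]` with `w_i > w_{i+1}`. -/
noncomputable def desF {m : ℕ} (w : Fin m → ℕ) : ℕ :=
  (Finset.univ.filter fun i : Fin (m - 1) =>
      w ⟨(i : ℕ) + 1, by have := i.2; omega⟩ < w ⟨(i : ℕ), by have := i.2; omega⟩).card

/-- The word `w = w₁ ⋯ w_m` has no double descent (no `i` with `w_i > w_{i+1} > w_{i+2}`). -/
def NDDF {m : ℕ} (w : Fin m → ℕ) : Prop :=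
  ∀ i : ℕ, ∀ h : i + 2 < m,
    ¬(w ⟨i + 1, by omega⟩ < w ⟨i, by omega⟩ ∧ w ⟨i + 2, h⟩ < w ⟨i + 1, by omega⟩)

/-- `w ∈ ℙ^n` is a parking function of length `n`: its weakly increasing rearrangement
`u = w ∘ σ` satisfies `u_i ≤ i` for all `i ∈ [n]` (positions 1-indexed). -/
def IsParkingFn {n : ℕ} (w : Fin n → ℕ) : Prop :=
  (∀ i, 1 ≤ w i) ∧
    ∃ σ : Equiv.Perm (Fin n), Monotone (w ∘ σ) ∧ ∀ i : Fin n, w (σ i) ≤ (i : ℕ) + 1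

/-- The (finite) set of all parking functions of length `n` (every parking function of
length `n` has all its letters in `[n]`). -/
noncomputable def pfFinset (n : ℕ) : Finset (Fin n → ℕ) :=
  (Fintype.piFinset fun _ : Fin n => Finset.Icc 1 n).filter IsParkingFn

set_option linter.unusedSectionVars false

section Runs

variable {A : Type*} [LinearOrder A] {R : Type*} [CommRing R]

/-- Product of `g` over lengths of maximal weakly increasing runs, first run being extended by `k`. -/
noncomputable def rwt (g : ℕ → R) : ℕ → List A → R
  | k, [] => g k
  | k, [_] => g (k + 1)
  | k, a :: b :: l => if a ≤ b then rwt g (k + 1) (b :: l) else g (k + 1) * rwt g 0 (b :: l)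

lemma rwt_map {B : Type*} [LinearOrder B] (g : ℕ → R) (f : A → B) (hf : StrictMono f) :
    ∀ (l : List A) (k : ℕ), rwt g k (l.map f) = rwt g k l
  | [], k => rfl
  | [a], k => rfl
  | a :: b :: l, k => by
    have h1 := rwt_map g f hf (b :: l)
    simp only [List.map_cons] at h1
    simp only [List.map_cons, rwt, h1, hf.le_iff_le]

lemma run_struct (g : ℕ → R) (g0 : g 0 = 1) :
    ∀ (l : List A) (a : A), ∃ L, 1 ≤ L ∧ L ≤ (a :: l).length ∧ ∃ r : R,
      (∀ k, rwt g k (a :: l) = g (k + L) * r) ∧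
      (∀ j, j ≤ L → ((a :: l).take j).Pairwise (· ≤ ·) ∧
        rwt g 0 ((a :: l).drop j) = g (L - j) * r) ∧
      (∀ j, L < j → j ≤ (a :: l).length → ¬ ((a :: l).take j).Pairwise (· ≤ ·))
  | [], a => by
    refine ⟨1, le_rfl, by simp, 1, by simp [rwt], ?_, ?_⟩
    · intro j hj
      interval_cases j <;> simp [rwt]
    · intro j h1 h2
      simp at h2; omega
  | b :: l, a => by
    obtain ⟨L, hL1, hL2, r, h1, h2, h3⟩ := run_struct g g0 l b
    by_cases hab : a ≤ b
    · refine ⟨L + 1, by omega, by simpa using hL2, r, ?_, ?_, ?_⟩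
      · intro k
        simp only [rwt, hab, if_true, h1]
        congr 2; omega
      · intro j hj
        rcases j with _ | j
        · simp only [List.take_zero, List.Pairwise.nil, true_and, List.drop_zero, rwt, hab, if_true, h1]
          congr 2; omega
        · obtain ⟨s1, s2⟩ := h2 j (by omega)
          refine ⟨?_, ?_⟩
          · rw [List.take_succ_cons, List.pairwise_cons]
            refine ⟨?_, s1⟩
            intro x hx
            rcases j with _ | j
            · simp at hx
            · rw [List.take_succ_cons] at hx s1
              rw [List.pairwise_cons] at s1
              rcases List.mem_cons.1 hx with rfl | hx
              · exact hab
              · exact hab.trans (s1.1 x hx)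
          · rw [List.drop_succ_cons, s2]
            congr 2; omega
      · intro j hj hj2
        rcases j with _ | j
        · omega
        · rw [List.take_succ_cons, List.pairwise_cons]
          exact fun h => h3 j (by omega) (by simpa using hj2) h.2
    · refine ⟨1, le_rfl, by simp, rwt g 0 (b :: l), ?_, ?_, ?_⟩
      · intro k
        simp only [rwt, hab, if_false]
      · intro j hj
        interval_cases j
        · simp [rwt, hab]
        · simp [g0]
      · intro j hj hj2 h
        obtain ⟨j, rfl⟩ : ∃ i, j = i + 2 := ⟨j - 2, by omega⟩
        simp only [List.take_succ_cons, List.pairwise_cons] at h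
        exact hab (h.1 b (by simp))

lemma rwt_decomp (g f : ℕ → R) (g0 : g 0 = 1)
    (hfg : ∀ L, 1 ≤ L → g L = ∑ j ∈ Finset.range L, f (j + 1) * g (L - (j + 1)))
    (n : ℕ) (l : List A) (hl : l.length = n + 1) :
    rwt g 0 l = ∑ j ∈ Finset.range (n + 1), f (j + 1) *
      (if (l.take (j + 1)).Pairwise (· ≤ ·) then 1 else 0) * rwt g 0 (l.drop (j + 1)) := by
  rcases l with _ | ⟨a, l⟩
  · simp at hl
  obtain ⟨L, hL1, hL2, r, h1, h2, h3⟩ := run_struct g g0 l a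
  rw [hl] at hL2 h3
  rw [h1, zero_add, hfg L hL1, Finset.sum_mul]
  rw [← Finset.sum_subset (Finset.range_subset_range.2 hL2)]
  · refine Finset.sum_congr rfl fun j hj => ?_
    rw [Finset.mem_range] at hj
    obtain ⟨s1, s2⟩ := h2 (j + 1) (by omega)
    rw [if_pos s1, s2]; ring
  · intro j hj hj2
    rw [Finset.mem_range] at hj hj2
    rw [if_neg (h3 (j + 1) (by omega) (by omega))]; ring

variable [Fintype A]

/-- Sum of `φ` over all words of length `n`. -/
noncomputable def wsum : ℕ → (List A → R) → R
  | 0, φ => φ []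
  | n + 1, φ => ∑ a : A, wsum n (fun l => φ (a :: l))

lemma wsum_eq : ∀ (n : ℕ) (φ : List A → R), wsum n φ = ∑ w : Fin n → A, φ (List.ofFn w)
  | 0, φ => by simp [wsum]
  | n + 1, φ => by
    rw [wsum, ← (Fin.consEquiv (fun _ : Fin (n + 1) => A)).sum_comp, Fintype.sum_prod_type]
    refine Finset.sum_congr rfl fun a _ => ?_
    rw [wsum_eq n]
    simp [Fin.consEquiv, List.ofFn_succ]

lemma wsum_congr (n : ℕ) (φ χ : List A → R) (h : ∀ l, l.length = n → φ l = χ l) :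
    wsum n φ = wsum n χ := by
  rw [wsum_eq, wsum_eq]
  exact Finset.sum_congr rfl fun w _ => h _ (by simp)

lemma wsum_add : ∀ (i j : ℕ) (φ : List A → R),
    wsum (i + j) φ = wsum i (fun u => wsum j (fun v => φ (u ++ v)))
  | 0, j, φ => by simp [wsum]
  | i + 1, j, φ => by
    rw [show i + 1 + j = (i + j) + 1 by ring, wsum, wsum]
    refine Finset.sum_congr rfl fun a _ => ?_
    rw [wsum_add i j]; rfl

lemma wsum_sum {ι : Type*} (s : Finset ι) (n : ℕ) (φ : ι → List A → R) :
    wsum n (fun l => ∑ i ∈ s, φ i l) = ∑ i ∈ s, wsum n (φ i) := by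
  simp only [wsum_eq]
  exact Finset.sum_comm

lemma wsum_mul (n : ℕ) (c : R) (φ : List A → R) :
    wsum n (fun l => c * φ l) = c * wsum n φ := by
  simp only [wsum_eq, Finset.mul_sum]

lemma wsum_sorted (n : ℕ) (χ : Multiset A → R) :
    wsum n (fun l : List A => (if l.Pairwise (· ≤ ·) then 1 else 0) * χ (l : Multiset A)) =
      ∑ s : Sym A n, χ (s : Multiset A) := by
  rw [wsum_eq]
  simp only [ite_mul, one_mul, zero_mul]
  rw [← Finset.sum_filter]
  refine Finset.sum_bij' (fun w _ => (Sym.mk (List.ofFn w : Multiset A) (by simp) : Sym A n))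
    (fun s _ => fun i => (Multiset.sort (s : Multiset A) (· ≤ ·)).get (i.cast (by simp))) ?_ ?_ ?_ ?_ ?_
  · intro w hw; exact Finset.mem_univ _
  · intro s hs
    simp only [Finset.mem_filter, Finset.mem_univ, true_and]
    rw [List.pairwise_ofFn]
    intro i j hij
    exact (List.pairwise_iff_get.1 (Multiset.pairwise_sort (s : Multiset A) (· ≤ ·))) _ _ (by simpa using hij)
  · intro w hw
    simp only [Finset.mem_filter, Finset.mem_univ, true_and] at hw
    have h : (List.ofFn w).mergeSort (fun x y => decide (x ≤ y)) = List.ofFn w := by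
      exact List.mergeSort_of_pairwise (by simpa using hw)
    funext i
    simp [h]
    rfl
  · intro s hs
    apply Sym.ext
    simp only [Sym.coe_mk]
    conv_rhs => rw [← Multiset.sort_eq (s : Multiset A) (· ≤ ·)]
    congr 1
    apply List.ext_get
    · simp
    · intro i h1 h2
      simp
  · intro w hw; rfl

/-- weighted sum of words -/
noncomputable def Tsum (g : ℕ → R) (n : ℕ) (ψ : Multiset A → R) : R :=
  wsum n (fun l : List A => rwt g 0 l * ψ (l : Multiset A))

lemma Tsum_rec (g f : ℕ → R) (g0 : g 0 = 1)
    (hfg : ∀ L, 1 ≤ L → g L = ∑ j ∈ Finset.range L, f (j + 1) * g (L - (j + 1)))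
    (n : ℕ) (ψ : Multiset A → R) :
    Tsum g (n + 1) ψ = ∑ j ∈ Finset.range (n + 1), f (j + 1) *
      ∑ s : Sym A (j + 1), Tsum g (n - j) (fun m => ψ ((s : Multiset A) + m)) := by
  unfold Tsum
  rw [wsum_congr (n + 1) _ (fun l => ∑ j ∈ Finset.range (n + 1), f (j + 1) *
      ((if (l.take (j + 1)).Pairwise (· ≤ ·) then 1 else 0) * (rwt g 0 (l.drop (j + 1)) *
        ψ (((l.take (j + 1) : List A) : Multiset A) + ((l.drop (j + 1) : List A) : Multiset A)))))]
  · rw [wsum_sum]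
    refine Finset.sum_congr rfl fun j hj => ?_
    rw [Finset.mem_range] at hj
    rw [wsum_mul]
    congr 1
    rw [← wsum_sorted (j + 1) (fun s => wsum (n - j) (fun l : List A => rwt g 0 l * ψ (s + (l : Multiset A))))]
    rw [show n + 1 = (j + 1) + (n - j) by omega, wsum_add]
    apply wsum_congr
    intro u hu
    rw [← wsum_mul]
    congr 1
    funext v
    rw [← hu, List.take_left, List.drop_left]
  · intro l hl
    rw [rwt_decomp g f g0 hfg n l hl, Finset.sum_mul]
    refine Finset.sum_congr rfl fun j hj => ?_
    rw [Multiset.coe_add, List.take_append_drop]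
    ring

lemma Tsum_perm (g f : ℕ → R) (g0 : g 0 = 1)
    (hfg : ∀ L, 1 ≤ L → g L = ∑ j ∈ Finset.range L, f (j + 1) * g (L - (j + 1)))
    (e : A ≃ A) (n : ℕ) : ∀ (ψ : Multiset A → R),
    Tsum g n (fun m => ψ (m.map e)) = Tsum g n ψ := by
  induction n using Nat.strong_induction_on with
  | _ n ih =>
    intro ψ
    rcases n with _ | n
    · simp [Tsum, wsum]
    · rw [Tsum_rec g f g0 hfg, Tsum_rec g f g0 hfg]
      refine Finset.sum_congr rfl fun j hj => ?_
      congr 1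
      conv_rhs => rw [← (Sym.equivCongr e).sum_comp]
      refine Finset.sum_congr rfl fun s _ => ?_
      conv_rhs => rw [← ih (n - j) (by omega)]
      simp [Sym.equivCongr]

lemma Tsum_series (g f : ℕ → R) (g0 : g 0 = 1)
    (hfg : ∀ L, 1 ≤ L → g L = ∑ j ∈ Finset.range L, f (j + 1) * g (L - (j + 1))) :
    (PowerSeries.mk fun n => Tsum g n (fun _ : Multiset A => (1 : R))) =
      1 + (PowerSeries.mk fun j => if j = 0 then 0 else
          f j * ((Nat.multichoose (Fintype.card A) j : ℕ) : R)) *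
        (PowerSeries.mk fun n => Tsum g n (fun _ : Multiset A => (1 : R))) := by
  ext n
  rcases n with _ | n
  · simp [Tsum, wsum, rwt, g0]
  · simp only [PowerSeries.coeff_mk, map_add, PowerSeries.coeff_mul]
    rw [Finset.Nat.sum_antidiagonal_eq_sum_range_succ (fun i j =>
      (if i = 0 then 0 else f i * ((Nat.multichoose (Fintype.card A) i : ℕ) : R)) *
        Tsum g j (fun _ : Multiset A => (1 : R))), Finset.sum_range_succ', Tsum_rec g f g0 hfg]
    simp [PowerSeries.coeff_one, Sym.card_sym_eq_multichoose, mul_assoc]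

end Runs

section Cycle

open scoped Fin.NatCast Fin.CommRing

/-- parking condition on multisets of residues -/
def Pk (n : ℕ) (s : Multiset (Fin (n + 1))) : Prop :=
  ∀ i, i ≤ n → i ≤ ∑ j ∈ Finset.range i, s.count ((j : ℕ) : Fin (n + 1))

lemma cycle_aux (n : ℕ) (c : ℕ → ℕ) (hp : ∀ j, c (j + (n + 1)) = c j)
    (hs : ∑ j ∈ Finset.range (n + 1), c j = n) :
    ∃! k : ℕ, k < n + 1 ∧ ∀ i, i ≤ n → i ≤ ∑ j ∈ Finset.range i, c (j + k) := by
  let G : ℕ → ℤ := fun i => (∑ j ∈ Finset.range i, (c j : ℤ)) - i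
  have hG : ∀ i, G (i + (n + 1)) = G i - 1 := by
    intro i
    induction i with
    | zero =>
      simp only [G, zero_add, Finset.range_zero, Finset.sum_empty]
      have : (∑ j ∈ Finset.range (n + 1), (c j : ℤ)) = n := by exact_mod_cast hs
      rw [this]; push_cast; ring
    | succ i ih =>
      have e1 : G (i + 1 + (n + 1)) = G (i + (n + 1)) + c i - 1 := by
        simp only [G]
        rw [show i + 1 + (n + 1) = (i + (n + 1)) + 1 by ring, Finset.sum_range_succ, hp]
        push_cast; ring
      have e2 : G (i + 1) = G i + c i - 1 := by
        simp only [G]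
        rw [Finset.sum_range_succ]
        push_cast; ring
      rw [e1, e2, ih]; ring
  have key : ∀ k i, (i ≤ ∑ j ∈ Finset.range i, c (j + k)) ↔ G k ≤ G (k + i) := by
    intro k i
    have : G (k + i) = G k + (∑ j ∈ Finset.range i, (c (j + k) : ℤ)) - i := by
      simp only [G]
      rw [Finset.sum_range_add]
      simp only [add_comm k]
      push_cast; ring
    rw [this]
    zify
    constructor <;> intro h <;> linarith
  simp only [key]
  obtain ⟨k0, hk0, hmin⟩ := Finset.exists_min_image (Finset.range (n + 1)) G ⟨0, by simp⟩
  have hex : ∃ k, k < n + 1 ∧ ∀ i, i < n + 1 → G k ≤ G i :=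
    ⟨k0, by simpa using hk0, fun i hi => hmin i (by simpa using hi)⟩
  have hk := Nat.find_spec hex
  have hfirst := fun m => Nat.find_min (H := hex) (m := m)
  set k := Nat.find hex
  refine ⟨k, ⟨hk.1, ?_⟩, ?_⟩
  · intro i hi
    by_cases h : k + i < n + 1
    · exact hk.2 _ h
    · obtain ⟨d, hd⟩ : ∃ d, k + i = d + (n + 1) := ⟨k + i - (n + 1), by omega⟩
      rw [hd, hG]
      have h1 := hk.2 d (by omega)
      have h2 : G d ≠ G k := by
        intro h2
        refine hfirst d (by omega) ⟨by omega, fun i hi => ?_⟩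
        rw [h2]; exact hk.2 i hi
      have : G k < G d := lt_of_le_of_ne h1 (Ne.symm h2)
      omega
  · have main : ∀ a b, a < b → b < n + 1 → (∀ i, i ≤ n → G a ≤ G (a + i)) →
        (∀ i, i ≤ n → G b ≤ G (b + i)) → False := by
      intro a b hab hb ha hb'
      have h1 := ha (b - a) (by omega)
      rw [show a + (b - a) = b by omega] at h1
      have h2 := hb' (a + (n + 1) - b) (by omega)
      rw [show b + (a + (n + 1) - b) = a + (n + 1) by omega, hG] at h2
      omega
    have hkk : ∀ i, i ≤ n → G k ≤ G (k + i) := by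
      intro i hi
      by_cases h : k + i < n + 1
      · exact hk.2 _ h
      · obtain ⟨d, hd⟩ : ∃ d, k + i = d + (n + 1) := ⟨k + i - (n + 1), by omega⟩
        rw [hd, hG]
        have h1 := hk.2 d (by omega)
        have h2 : G d ≠ G k := by
          intro h2
          refine hfirst d (by omega) ⟨by omega, fun i hi => ?_⟩
          rw [h2]; exact hk.2 i hi
        have : G k < G d := lt_of_le_of_ne h1 (Ne.symm h2)
        omega
    rintro y ⟨hy1, hy2⟩
    rcases lt_trichotomy y k with h | h | h
    · exact (main y k h hk.1 hy2 hkk).elim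
    · exact h
    · exact (main k y h hy1 hkk hy2).elim

lemma sum_count_fin (n : ℕ) (s : Multiset (Fin (n + 1))) :
    ∑ j ∈ Finset.range (n + 1), s.count ((j : ℕ) : Fin (n + 1)) = s.card := by
  rw [← Fin.sum_univ_eq_sum_range (fun j => s.count ((j : ℕ) : Fin (n + 1)))]
  simp only [Fin.cast_val_eq_self]
  exact Multiset.sum_count_eq_card (by simp)

lemma cycle_lemma (n : ℕ) (s : Multiset (Fin (n + 1))) (hs : s.card = n) :
    ∃! k : Fin (n + 1), Pk n (s.map (Equiv.subRight k)) := by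
  have hc : ∀ (k : Fin (n + 1)) (x : Fin (n + 1)),
      (s.map (Equiv.subRight k)).count x = s.count (x + k) := by
    intro k x
    have := Multiset.count_map_eq_count' (Equiv.subRight k) s (Equiv.subRight k).injective (x + k)
    simpa using this
  have h := cycle_aux n (fun j => s.count ((j : ℕ) : Fin (n + 1)))
    (by intro j; simp) (by rw [sum_count_fin, hs])
  obtain ⟨k, ⟨hk1, hk2⟩, hu⟩ := h
  refine ⟨(k : Fin (n + 1)), ?_, ?_⟩
  · intro i hi
    simp only [hc]
    simpa using hk2 i hi
  · intro y hy
    have := hu y.val ⟨y.2, fun i hi => by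
      have := hy i hi
      simp only [hc] at this
      simpa using this⟩
    rw [← this]; simp

end Cycle

section Series

variable {R : Type*} [CommRing R]

/-- weights for descents -/
noncomputable def gA (t : R) (j : ℕ) : R := if j = 0 then 1 else t
/-- inverse weights for descents -/
noncomputable def fA (t : R) (j : ℕ) : R := t * (1 - t) ^ (j - 1)
/-- weights for the gamma expansion -/
noncomputable def gC (t : R) : ℕ → R
  | 0 => 1
  | 1 => 0
  | j + 2 => t * (t + 1) ^ j
/-- inverse weights for the gamma expansion -/
noncomputable def fC (t : R) (j : ℕ) : R := t * ∑ i ∈ Finset.range (j - 1), t ^ i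

lemma hfgA (t : R) : ∀ L, 1 ≤ L → (gA t) L = ∑ j ∈ Finset.range L, (fA t) (j + 1) * (gA t) (L - (j + 1)) := by
  intro L hL
  obtain ⟨M, rfl⟩ : ∃ M, L = M + 1 := ⟨L - 1, by omega⟩
  rw [Finset.sum_range_succ]
  have h1 : ∑ j ∈ Finset.range M, (fA t) (j + 1) * (gA t) (M + 1 - (j + 1)) =
      ∑ j ∈ Finset.range M, (t * (1 - t) ^ j : R) * t := by
    refine Finset.sum_congr rfl fun j hj => ?_
    rw [Finset.mem_range] at hj
    simp [fA, gA, show M - j ≠ 0 by omega]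
  rw [h1, ← Finset.sum_mul]
  have h2 : ∀ M : ℕ, ∑ j ∈ Finset.range M, (t * (1 - t) ^ j : R) = 1 - (1 - t) ^ M := by
    intro M
    induction M with
    | zero => simp
    | succ M ih => rw [Finset.sum_range_succ, ih]; ring
  rw [h2]
  simp [gA, fA]; ring

lemma fC_rec (t : R) (M : ℕ) : (fC t) (M + 3) + t * (fC t) (M + 1) = (t + 1) * (fC t) (M + 2) := by
  simp only [fC, Nat.add_sub_cancel, show M + 3 - 1 = M + 2 by omega, show M + 2 - 1 = M + 1 by omega]
  rw [Finset.sum_range_succ, Finset.sum_range_succ]; ring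

lemma hfgC (t : R) : ∀ L, 1 ≤ L → (gC t) L = ∑ j ∈ Finset.range L, (fC t) (j + 1) * (gC t) (L - (j + 1)) := by
  intro L hL
  obtain ⟨M, rfl⟩ : ∃ M, L = M + 1 := ⟨L - 1, by omega⟩
  rcases M with _ | M
  · simp [gC, fC]
  rw [Finset.sum_range_succ, Finset.sum_range_succ]
  have h1 : ∑ j ∈ Finset.range M, (fC t) (j + 1) * (gC t) (M + 1 + 1 - (j + 1)) =
      t * ∑ j ∈ Finset.range M, (fC t) (j + 1) * (t + 1) ^ (M - 1 - j) := by
    rw [Finset.mul_sum]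
    refine Finset.sum_congr rfl fun j hj => ?_
    rw [Finset.mem_range] at hj
    rw [show M + 1 + 1 - (j + 1) = (M - 1 - j) + 2 by omega, gC]; ring
  rw [h1]
  have h2 : ∀ M : ℕ, (fC t) (M + 2) + t * ∑ j ∈ Finset.range M, (fC t) (j + 1) * (t + 1) ^ (M - 1 - j) =
      t * (t + 1) ^ M := by
    intro M
    induction M with
    | zero => simp [fC]
    | succ M ih =>
      rw [Finset.sum_range_succ]
      have : ∑ j ∈ Finset.range M, (fC t) (j + 1) * (t + 1) ^ (M + 1 - 1 - j) =
        (t + 1) * ∑ j ∈ Finset.range M, (fC t) (j + 1) * (t + 1) ^ (M - 1 - j) := by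
        rw [Finset.mul_sum]
        refine Finset.sum_congr rfl fun j hj => ?_
        rw [Finset.mem_range] at hj
        rw [show M + 1 - 1 - j = (M - 1 - j) + 1 by omega]; ring
      rw [this, pow_succ]
      simp only [Nat.add_sub_cancel, Nat.sub_self, pow_zero]
      linear_combination (t + 1) * ih + fC_rec t M
  rw [show M + 1 + 1 - (M + 1) = 1 by omega, Nat.sub_self]
  simp only [gC]
  linear_combination - h2 M

local notation "zz" => (PowerSeries.X : PowerSeries R)
local notation "cc" => (PowerSeries.C : R →+* PowerSeries R)

/-- series of complete homogeneous evaluations -/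
noncomputable def Hs (m : ℕ) : PowerSeries R := PowerSeries.mk fun j => ((Nat.multichoose m j : ℕ) : R)

lemma Hs_mul (n : ℕ) : (Hs (n + 1) : PowerSeries R) * (1 - zz) ^ (n + 1) = 1 := by
  refine Eq.trans ?_ (PowerSeries.mk_add_choose_mul_one_sub_pow_eq_one R n)
  congr 1
  ext j : 1
  simp only [Hs, PowerSeries.coeff_mk, Nat.multichoose_eq]
  rw [show n + 1 + j - 1 = n + j by omega, Nat.choose_symm_add]

lemma Hs_rescale (n : ℕ) (a : R) :
    PowerSeries.rescale a (Hs (n + 1)) * (1 - cc a * zz) ^ (n + 1) = 1 := by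
  have := congrArg (PowerSeries.rescale a) (Hs_mul n)
  simpa [PowerSeries.rescale_X] using this

/-- `z/(1-tz)` -/
noncomputable def aS (t : R) : PowerSeries R := zz * PowerSeries.rescale t (PowerSeries.mk 1)

lemma aS_mul (t : R) : aS t * (1 - cc t * zz) = zz := by
  have h := congrArg (PowerSeries.rescale (t : R)) (PowerSeries.mk_one_mul_one_sub_eq_one R)
  simp only [map_mul, map_sub, map_one, PowerSeries.rescale_X] at h
  rw [aS, mul_assoc, h, mul_one]

lemma aS_subst (t : R) : PowerSeries.HasSubst (aS t) :=
  PowerSeries.HasSubst.of_constantCoeff_zero' (by simp [aS])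

lemma coeff_aS_pow (t : R) (n e : ℕ) : PowerSeries.coeff (n + 1) (aS t ^ (e + 1)) =
    if e ≤ n then ((n.choose e : ℕ) : R) * t ^ (n - e) else 0 := by
  rw [aS, mul_pow, PowerSeries.coeff_X_pow_mul', ← map_pow, PowerSeries.mk_one_pow_eq_mk_choose_add]
  by_cases h : e ≤ n
  · rw [if_pos h, if_pos (by omega), PowerSeries.coeff_rescale, PowerSeries.coeff_mk]
    rw [show n + 1 - (e + 1) = n - e by omega, show e + (n - e) = n by omega]; ring
  · rw [if_neg h, if_neg (by omega)]

lemma coeff_subst_aS (t : R) (P : PowerSeries R) (n : ℕ) :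
    PowerSeries.coeff (n + 1) (P.subst (aS t)) =
      ∑ k ∈ Finset.range (n + 1), ((n.choose k : ℕ) : R) * t ^ k * PowerSeries.coeff (n + 1 - k) P := by
  rw [PowerSeries.coeff_subst' (aS_subst t)]
  rw [finsum_eq_sum_of_support_subset (s := Finset.range (n + 2))]
  · rw [Finset.sum_range_succ', ← Finset.sum_range_reflect]
    simp only [pow_zero, PowerSeries.coeff_one, Nat.add_eq_zero_iff, one_ne_zero, and_false, if_false,
      smul_zero, add_zero]
    refine Finset.sum_congr rfl fun k hk => ?_
    rw [Finset.mem_range] at hk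
    rw [coeff_aS_pow, if_pos (by omega), smul_eq_mul]
    rw [show n + 1 - 1 - k + 1 = n + 1 - k by omega, show n + 1 - 1 - k = n - k by omega,
      show n - (n - k) = k by omega, Nat.choose_symm (by omega)]; ring
  · intro d hd
    simp only [Finset.coe_range, Set.mem_Iio]
    by_contra hlt
    apply hd
    obtain ⟨e, rfl⟩ : ∃ e, d = e + 1 := ⟨d - 1, by omega⟩
    simp only
    rw [coeff_aS_pow, if_neg (by omega), smul_zero]

lemma subst_aS_zero (t : R) (P : PowerSeries R) (h : PowerSeries.coeff 0 P = 1) :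
    PowerSeries.coeff 0 (P.subst (aS t)) = 1 := by
  rw [PowerSeries.coeff_subst' (aS_subst t), finsum_eq_single _ 0]
  · simpa using h
  · intro d hd
    simp [aS, hd]

theorem series_main [IsDomain R] (t : R) (ht0 : t ≠ 0) (ht1 : t - 1 ≠ 0) (n : ℕ) (a : ℕ → R)
    (ha : ∀ i, Tsum (gA t) (i + 1) (fun _ : Multiset (Fin (n + 1)) => (1 : R)) = t * a (i + 1)) :
    (PowerSeries.mk fun N => Tsum (gC t) N (fun _ : Multiset (Fin (n + 1)) => (1 : R))) =
      (1 - zz) ^ (n + 1) * PowerSeries.mk fun j => if j = 0 then 1 else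
        ∑ k ∈ Finset.range j, (((j - 1).choose k : ℕ) : R) * (t ^ k * a (j - k)) := by
  have eA := Tsum_series (A := Fin (n + 1)) (gA t) (fA t) (by simp [gA]) (hfgA t)
  have eC := Tsum_series (A := Fin (n + 1)) (gC t) (fC t) (by simp [gC]) (hfgC t)
  rw [Fintype.card_fin] at eA eC
  set PA := PowerSeries.mk fun N => Tsum (gA t) N (fun _ : Multiset (Fin (n + 1)) => (1 : R)) with hPA
  set PC := PowerSeries.mk fun N => Tsum (gC t) N (fun _ : Multiset (Fin (n + 1)) => (1 : R)) with hPC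
  set B : PowerSeries R := PowerSeries.mk fun j => if j = 0 then 1 else
        ∑ k ∈ Finset.range j, (((j - 1).choose k : ℕ) : R) * (t ^ k * a (j - k)) with hB
  set FA := PowerSeries.mk fun j => if j = 0 then 0 else
          (fA t) j * ((Nat.multichoose (n + 1) j : ℕ) : R) with hFA
  set FC := PowerSeries.mk fun j => if j = 0 then 0 else
          (fC t) j * ((Nat.multichoose (n + 1) j : ℕ) : R) with hFC
  have h1 : cc (1 - t) * FA = cc t * (PowerSeries.rescale (1 - t) (Hs (n + 1)) - 1) := by
    ext j : 1
    rw [PowerSeries.coeff_C_mul, PowerSeries.coeff_C_mul, map_sub, PowerSeries.coeff_rescale]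
    rcases j with _ | j
    · simp [hFA, Hs]
    · simp [hFA, Hs, PowerSeries.coeff_one, fA]
      ring
  have h2 : cc (t - 1) * FC = (PowerSeries.rescale t (Hs (n + 1)) - 1) - cc t * (Hs (n + 1) - 1) := by
    ext j : 1
    rw [PowerSeries.coeff_C_mul, map_sub, PowerSeries.coeff_C_mul, map_sub, map_sub, PowerSeries.coeff_rescale]
    rcases j with _ | j
    · simp [hFC, Hs]
    · have := geom_sum_mul t j
      simp [hFC, Hs, PowerSeries.coeff_one, fC]
      linear_combination t * (((n + 1).multichoose (j + 1) : ℕ) : R) * this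
  have r0 := Hs_mul (R := R) n
  have r1 := Hs_rescale n (1 - t)
  have r2 := Hs_rescale n t
  -- relation for PA
  have kA : PA * ((1 - cc (1 - t) * zz) ^ (n + 1) - cc t) = cc (1 - t) * (1 - cc (1 - t) * zz) ^ (n + 1) := by
    have e1 : cc (1 - t) = 1 - cc t := by simp
    set Q := (1 - cc (1 - t) * zz) ^ (n + 1)
    have : PA * (1 - FA) = 1 := by linear_combination eA
    linear_combination (cc (1 - t)) * Q * this + PA * Q * h1 + PA * cc t * r1 - PA * Q * e1
  have kB := congrArg (PowerSeries.substAlgHom (R := R) (aS_subst t)) kA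
  have hC : ∀ c : R, PowerSeries.substAlgHom (R := R) (aS_subst t) (cc c) = cc c := by
    intro c
    exact (PowerSeries.substAlgHom (R := R) (aS_subst t)).commutes c
  simp only [map_mul, map_sub, map_pow, map_one, hC, PowerSeries.substAlgHom_X] at kB
  have hBt : PowerSeries.substAlgHom (R := R) (aS_subst t) PA = 1 + cc t * (B - 1) := by
    rw [PowerSeries.coe_substAlgHom]
    ext N : 1
    rcases N with _ | N
    · rw [subst_aS_zero]
      · simp [hB]
      · simp [hPA, Tsum, wsum, rwt, gA]
    · rw [coeff_subst_aS]
      simp only [hPA, hB, PowerSeries.coeff_mk, map_add, map_sub, PowerSeries.coeff_C_mul,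
        PowerSeries.coeff_one, Nat.add_eq_zero_iff, one_ne_zero, and_false, if_false, zero_add, sub_zero,
        Nat.add_sub_cancel, Finset.mul_sum]
      refine Finset.sum_congr rfl fun k hk => ?_
      rw [Finset.mem_range] at hk
      rw [show N + 1 - k = (N - k) + 1 by omega, ha]; ring
  rw [hBt] at kB
  have hX : cc t ≠ 0 := by
    intro h
    have := congrArg (PowerSeries.coeff 0) h
    simp at this
    exact ht0 this
  set q := (1 - cc t * zz) ^ (n + 1) with hq
  set p := (1 - zz) ^ (n + 1) with hp
  have hpow : (1 - (1 - cc t) * aS t) ^ (n + 1) * q = p := by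
    rw [hq, hp, ← mul_pow]
    congr 1
    linear_combination (cc t - 1) * aS_mul t
  set s := (1 - (1 - cc t) * aS t) ^ (n + 1)
  have kB2 : B * (cc t * q - p) = (cc t - 1) * q := by
    apply mul_left_cancel₀ hX
    linear_combination (-q) * kB + (1 + cc t * (B - 1) - (1 - cc t)) * hpow
  have e1 : cc (t - 1) = cc t - 1 := by simp
  rw [e1] at h2
  have kC : PC * (cc t * q - p) = (cc t - 1) * p * q := by
    have h3 : PC * (1 - FC) = 1 := by linear_combination eC
    linear_combination (cc t - 1) * p * q * h3 + PC * p * q * h2 + PC * p * r2 - PC * cc t * q * r0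
  have hne : cc t * q - p ≠ 0 := by
    intro h
    have := congrArg (PowerSeries.coeff 0) h
    simp [hq, hp] at this
    exact ht1 this
  apply mul_right_cancel₀ hne
  rw [kC]
  linear_combination (-p) * kB2

lemma coeff_one_sub_pow (m r : ℕ) : PowerSeries.coeff r ((1 - zz) ^ m) =
    (-1) ^ r * ((m.choose r : ℕ) : R) := by
  have h : (1 - zz) ^ m = (((1 - Polynomial.X : R[X]) ^ m : R[X]) : PowerSeries R) := by simp
  have h2 : (1 - Polynomial.X : R[X]) ^ m = ((1 + Polynomial.X) ^ m : R[X]).comp (Polynomial.C (-1) * Polynomial.X) := by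
    simp [sub_eq_add_neg]
  rw [h, Polynomial.coeff_coe, h2, Polynomial.comp_C_mul_X_coeff, Polynomial.coeff_one_add_X_pow, mul_comm]

end Series

section Translate

/-- descents of an infinite word up to length `n` -/
def desN (n : ℕ) (v : ℕ → ℕ) : ℕ := ((Finset.range (n - 1)).filter fun i => v (i + 1) < v i).card

lemma desN_succ (n : ℕ) (v : ℕ → ℕ) :
    desN (n + 2) v = (if v 1 < v 0 then 1 else 0) + desN (n + 1) (fun i => v (i + 1)) := by
  simp only [desN, Finset.card_filter, show n + 2 - 1 = n + 1 by omega, Nat.add_sub_cancel]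
  rw [Finset.sum_range_succ', add_comm]

lemma desF_eq (n : ℕ) (v : ℕ → ℕ) : desF (fun i : Fin n => v i) = desN n v := by
  simp only [desF, desN, Finset.card_filter]
  rw [← Fin.sum_univ_eq_sum_range (fun i => if v (i + 1) < v i then 1 else 0)]

lemma ofFn_cons (n : ℕ) (v : ℕ → ℕ) :
    List.ofFn (fun i : Fin (n + 1) => v i) = v 0 :: List.ofFn (fun i : Fin n => v (i + 1)) := by
  simp [List.ofFn_succ]

variable {R : Type*} [CommRing R]

lemma rwt_gA (t : R) : ∀ (n k : ℕ) (v : ℕ → ℕ),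
    rwt (gA t) k (List.ofFn (fun i : Fin (n + 1) => v i)) = t ^ (desN (n + 1) v + 1) := by
  intro n
  induction n with
  | zero => intro k v; simp [rwt, gA, desN]
  | succ n ih =>
    intro k v
    have := fun k => ih k (fun i => v (i + 1))
    rw [ofFn_cons, ofFn_cons n (fun i => v (i + 1)), rwt, ← ofFn_cons n (fun i => v (i + 1)), this, this,
      desN_succ]
    by_cases h : v 0 ≤ v 1
    · simp [h, not_lt.2 h]
    · simp only [zero_add, h, if_false, gA, not_le.1 h, if_true]
      simp; ring

/-- the sparse descent condition -/
def good (k n : ℕ) (v : ℕ → ℕ) : Prop :=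
  (∀ i, i + 2 < n → ¬ (v (i + 1) < v i ∧ v (i + 2) < v (i + 1))) ∧
  (k = 0 → 1 < n ∧ v 0 ≤ v 1) ∧ (1 < n → v (n - 2) ≤ v (n - 1))

lemma good_asc (k n : ℕ) (v : ℕ → ℕ) (h : v 0 ≤ v 1) :
    good k (n + 2) v ↔ good (k + 1) (n + 1) (fun i => v (i + 1)) := by
  constructor
  · rintro ⟨h1, h2, h3⟩
    refine ⟨fun i hi => h1 (i + 1) (by omega), by omega, fun hn => ?_⟩
    obtain ⟨m, rfl⟩ : ∃ m, n = m + 1 := ⟨n - 1, by omega⟩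
    exact h3 (by omega)
  · rintro ⟨h1, h2, h3⟩
    refine ⟨fun i hi => ?_, fun _ => ⟨by omega, h⟩, fun hn => ?_⟩
    · rcases i with _ | i
      · intro h4; exact absurd h4.1 (not_lt.2 h)
      · exact h1 i (by omega)
    · rcases n with _ | n
      · exact h
      · exact h3 (by omega)

lemma good_desc (k n : ℕ) (v : ℕ → ℕ) (h : v 1 < v 0) :
    good k (n + 2) v ↔ k ≠ 0 ∧ good 0 (n + 1) (fun i => v (i + 1)) := by
  constructor
  · rintro ⟨h1, h2, h3⟩
    refine ⟨fun hk => absurd h (not_lt.2 (h2 hk).2), fun i hi => h1 (i + 1) (by omega), fun _ => ?_, fun hn => ?_⟩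
    · rcases n with _ | n
      · exact absurd h (not_lt.2 (h3 (by omega)))
      · refine ⟨by omega, ?_⟩
        have := h1 0 (by omega)
        simp only [zero_add] at this ⊢
        exact not_lt.1 fun h5 => this ⟨h, h5⟩
    · obtain ⟨m, rfl⟩ : ∃ m, n = m + 1 := ⟨n - 1, by omega⟩
      exact h3 (by omega)
  · rintro ⟨hk, h1, h2, h3⟩
    obtain ⟨hn, h2'⟩ := h2 rfl
    obtain ⟨m, rfl⟩ : ∃ m, n = m + 1 := ⟨n - 1, by omega⟩
    refine ⟨fun i hi => ?_, fun h => absurd h hk, fun _ => h3 hn⟩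
    rcases i with _ | i
    · exact fun h4 => absurd h4.2 (not_lt.2 h2')
    · exact h1 i (by omega)

lemma rwt_gC (t : R) : ∀ (n k : ℕ) (v : ℕ → ℕ),
    (good k (n + 1) v → ∃ e, e + 2 * (desN (n + 1) v + 1) = k + n + 1 ∧
      rwt (gC t) k (List.ofFn (fun i : Fin (n + 1) => v i)) = t ^ (desN (n + 1) v + 1) * (t + 1) ^ e) ∧
    (¬ good k (n + 1) v → rwt (gC t) k (List.ofFn (fun i : Fin (n + 1) => v i)) = 0) := by
  intro n
  induction n with
  | zero =>
    intro k v
    have hg : good k (0 + 1) v ↔ k ≠ 0 := by simp [good]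
    rw [hg]
    constructor
    · intro hk
      obtain ⟨j, rfl⟩ : ∃ j, k = j + 1 := ⟨k - 1, by omega⟩
      refine ⟨j, by simp [desN], ?_⟩
      simp [rwt, gC, desN]
    · intro hk
      obtain rfl : k = 0 := by simpa using hk
      simp [rwt, gC]
  | succ n ih =>
    intro k v
    rw [ofFn_cons, ofFn_cons n (fun i => v (i + 1)), rwt, ← ofFn_cons n (fun i => v (i + 1)), desN_succ]
    by_cases h : v 0 ≤ v 1
    · rw [good_asc k n v h]
      obtain ⟨h1, h2⟩ := ih (k + 1) (fun i => v (i + 1))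
      simp only [zero_add, h, not_lt.2 h, if_true, if_false]
      refine ⟨fun hg => ?_, h2⟩
      obtain ⟨e, he, h3⟩ := h1 hg
      exact ⟨e, by omega, h3⟩
    · have h' := not_le.1 h
      rw [good_desc k n v h']
      obtain ⟨h1, h2⟩ := ih 0 (fun i => v (i + 1))
      simp only [zero_add, h, h', if_true, if_false]
      constructor
      · rintro ⟨hk, hg⟩
        obtain ⟨j, rfl⟩ : ∃ j, k = j + 1 := ⟨k - 1, by omega⟩
        obtain ⟨e, he, h3⟩ := h1 hg
        refine ⟨e + j, by omega, ?_⟩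
        rw [h3, gC]; ring
      · intro hg
        by_cases hk : k = 0
        · subst hk; simp [gC]
        · rw [h2 fun h5 => hg ⟨hk, h5⟩, mul_zero]

/-- extension of a finite word -/
def ext0 {n : ℕ} (w : Fin n → ℕ) : ℕ → ℕ := fun i => if h : i < n then w ⟨i, h⟩ else 0

lemma ext0_eq {n : ℕ} (w : Fin n → ℕ) : (fun i : Fin n => ext0 w i) = w := by
  funext i; simp [ext0]

lemma ext0_lt {n : ℕ} (w : Fin n → ℕ) (i : ℕ) (h : i < n) : ext0 w i = w ⟨i, h⟩ := by
  simp [ext0, h]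

lemma rwt_gA_word (t : R) (n : ℕ) (w : Fin (n + 1) → ℕ) :
    rwt (gA t) 0 (List.ofFn w) = t ^ (desF w + 1) := by
  conv_lhs => rw [← ext0_eq w]
  conv_rhs => rw [← ext0_eq w]
  rw [rwt_gA, desF_eq]

lemma rwt_gC_word (t : R) (n : ℕ) (hn : 2 ≤ n) (w : Fin n → ℕ)
    (p0 : 0 < n) (p1 : 1 < n) (p2 : n - 2 < n) (p3 : n - 1 < n) :
    rwt (gC t) 0 (List.ofFn w) = if (NDDF w ∧ w ⟨0, p0⟩ ≤ w ⟨1, p1⟩ ∧ w ⟨n - 2, p2⟩ ≤ w ⟨n - 1, p3⟩) then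
        t ^ (desF w + 1) * (t + 1) ^ (n - 2 - 2 * desF w) else 0 := by
  obtain ⟨m, rfl⟩ : ∃ m, n = m + 1 := ⟨n - 1, by omega⟩
  have hg : good 0 (m + 1) (ext0 w) ↔ (NDDF w ∧ w ⟨0, p0⟩ ≤ w ⟨1, p1⟩ ∧
              w ⟨m + 1 - 2, p2⟩ ≤ w ⟨m + 1 - 1, p3⟩) := by
    rw [← ext0_lt w 0 (by omega), ← ext0_lt w 1 (by omega), ← ext0_lt w (m + 1 - 2) (by omega),
      ← ext0_lt w (m + 1 - 1) (by omega)]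
    constructor
    · rintro ⟨h1, h2, h3⟩
      refine ⟨fun i h => ?_, (h2 rfl).2, h3 (by omega)⟩
      rw [← ext0_lt w i (by omega), ← ext0_lt w (i + 1) (by omega), ← ext0_lt w (i + 2) (by omega)]
      exact h1 i h
    · rintro ⟨h1, h2, h3⟩
      refine ⟨fun i h => ?_, fun _ => ⟨by omega, h2⟩, fun _ => h3⟩
      rw [ext0_lt w i (by omega), ext0_lt w (i + 1) (by omega), ext0_lt w (i + 2) (by omega)]
      exact h1 i h
  obtain ⟨h1, h2⟩ := rwt_gC t m 0 (ext0 w)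
  rw [ext0_eq, ← desF_eq, ext0_eq] at h1
  rw [ext0_eq] at h2
  split_ifs with h
  · obtain ⟨e, he, h3⟩ := h1 (hg.2 h)
    rw [h3]
    congr 2; omega
  · exact h2 fun h5 => h (hg.1 h5)

lemma sum_icc_words (n m : ℕ) (φ : (Fin n → ℕ) → R) :
    ∑ w ∈ Fintype.piFinset (fun _ : Fin n => Finset.Icc 1 m), φ w =
      ∑ w : Fin n → Fin m, φ (fun i => (w i : ℕ) + 1) := by
  symm
  refine Finset.sum_bij (fun w _ => fun i => (w i : ℕ) + 1) ?_ ?_ ?_ ?_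
  · intro w _
    simp only [Fintype.mem_piFinset, Finset.mem_Icc]
    intro i
    have := (w i).2
    omega
  · intro w _ w' _ h
    funext i
    have h2 : (w i : ℕ) + 1 = (w' i : ℕ) + 1 := congrFun h i
    exact Fin.ext (by omega)
  · intro w hw
    simp only [Fintype.mem_piFinset, Finset.mem_Icc] at hw
    refine ⟨fun i => ⟨w i - 1, by have := hw i; omega⟩, Finset.mem_univ _, ?_⟩
    funext i
    have := hw i
    change w i - 1 + 1 = w i
    omega
  · intro w _; rfl

open scoped Fin.NatCast Fin.CommRing in
lemma sum_count_ofFn (n i : ℕ) (hi : i ≤ n) (w : Fin n → Fin (n + 1)) :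
    ∑ j ∈ Finset.range i, (List.ofFn w : Multiset (Fin (n + 1))).count ((j : ℕ) : Fin (n + 1)) =
      (Finset.univ.filter fun x : Fin n => (w x : ℕ) + 1 ≤ i).card := by
  have h : (List.ofFn w : Multiset (Fin (n + 1))) = (Finset.univ : Finset (Fin n)).val.map w := by
    rw [List.ofFn_eq_map]; rfl
  simp only [h, Multiset.count_map]
  rw [Finset.card_eq_sum_card_fiberwise (f := fun x => (w x : ℕ)) (t := Finset.range i)]
  · refine Finset.sum_congr rfl fun j hj => ?_
    rw [Finset.mem_range] at hj
    rw [Finset.filter_filter]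
    change (Finset.univ.filter _).card = _
    congr 1
    ext x
    simp only [Finset.mem_filter, Finset.mem_univ, true_and, Fin.ext_iff, Fin.val_natCast]
    rw [Nat.mod_eq_of_lt (by omega)]
    omega
  · intro x hx
    simp only [Finset.coe_filter, Finset.mem_univ, true_and, Set.mem_ofPred_eq] at hx
    simp; omega

lemma parking_iff (n : ℕ) (w : Fin n → Fin (n + 1)) :
    IsParkingFn (fun i => (w i : ℕ) + 1) ↔ Pk n (List.ofFn w : Multiset (Fin (n + 1))) := by
  have e : Pk n (List.ofFn w : Multiset (Fin (n + 1))) ↔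
      ∀ i, i ≤ n → i ≤ (Finset.univ.filter fun x : Fin n => (w x : ℕ) + 1 ≤ i).card := by
    unfold Pk
    refine forall_congr' fun i => forall_congr' fun hi => ?_
    rw [sum_count_ofFn n i hi]
  rw [e]
  constructor
  · rintro ⟨-, σ, hm, hσ⟩ i hi
    calc i = ((Finset.univ.filter fun x : Fin n => (x : ℕ) < i).map σ.toEmbedding).card := by
          rw [Finset.card_map, Fin.card_filter_val_lt]; omega
      _ ≤ _ := by
          apply Finset.card_le_card
          intro x hx
          simp only [Finset.mem_map, Finset.mem_filter, Finset.mem_univ, true_and] at hx ⊢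
          obtain ⟨y, hy, rfl⟩ := hx
          have := hσ y
          simp only at this
          simp only [Equiv.coe_toEmbedding]
          omega
  · intro h
    refine ⟨fun i => Nat.le_add_left 1 _, Tuple.sort (fun i => (w i : ℕ) + 1), Tuple.monotone_sort _, ?_⟩
    intro i
    by_contra hlt
    set σ := Tuple.sort (fun i => (w i : ℕ) + 1)
    have hm : Monotone ((fun i => (w i : ℕ) + 1) ∘ σ) := Tuple.monotone_sort _
    have h1 := h (i + 1) (by omega)
    have h2 : (Finset.univ.filter fun x : Fin n => (w x : ℕ) + 1 ≤ i + 1).card ≤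
        ((Finset.univ.filter fun x : Fin n => (x : ℕ) < i).map σ.toEmbedding).card := by
      apply Finset.card_le_card
      intro x hx
      simp only [Finset.mem_map, Finset.mem_filter, Finset.mem_univ, true_and] at hx ⊢
      refine ⟨σ.symm x, ?_, by simp⟩
      by_contra hge
      have := hm (show i ≤ σ.symm x from not_lt.1 hge)
      simp only [Function.comp_apply, Equiv.apply_symm_apply] at this hlt
      omega
    rw [Finset.card_map, Fin.card_filter_val_lt] at h2
    omega

lemma sum_pf (n : ℕ) (φ : (Fin n → ℕ) → R) :
    ∑ w ∈ pfFinset n, φ w = ∑ w : Fin n → Fin (n + 1),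
      φ (fun i => (w i : ℕ) + 1) * (if Pk n (List.ofFn w : Multiset (Fin (n + 1))) then 1 else 0) := by
  have e : pfFinset n = (Fintype.piFinset fun _ : Fin n => Finset.Icc 1 (n + 1)).filter IsParkingFn := by
    ext w
    simp only [pfFinset, Finset.mem_filter, Fintype.mem_piFinset, Finset.mem_Icc]
    constructor
    · rintro ⟨h, hp⟩
      exact ⟨fun i => ⟨(h i).1, by have := (h i).2; omega⟩, hp⟩
    · rintro ⟨h, hp⟩
      refine ⟨fun i => ⟨(h i).1, ?_⟩, hp⟩
      obtain ⟨-, σ, -, hσ⟩ := hp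
      have := hσ (σ.symm i)
      have h2 := (σ.symm i).2
      simp only [Equiv.apply_symm_apply] at this
      omega
  rw [e, Finset.sum_filter, sum_icc_words]
  refine Finset.sum_congr rfl fun w _ => ?_
  simp only [parking_iff, mul_ite, mul_one, mul_zero]

lemma strictMono_succ (m : ℕ) : StrictMono (fun x : Fin m => (x : ℕ) + 1) := by
  intro a b h
  have : (a : ℕ) < b := h
  change (a : ℕ) + 1 < (b : ℕ) + 1
  omega

lemma rwt_ofFn_val (g : ℕ → R) (n m : ℕ) (w : Fin n → Fin m) :
    rwt g 0 (List.ofFn (fun i => (w i : ℕ) + 1)) = rwt g 0 (List.ofFn w) := by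
  rw [← rwt_map g (fun x : Fin m => (x : ℕ) + 1) (strictMono_succ m)]
  congr 1
  rw [List.map_ofFn]; rfl

lemma Tsum_parking (t : R) (n : ℕ) :
    Tsum (gC t) n (fun _ : Multiset (Fin (n + 1)) => (1 : R)) =
      ((n : R) + 1) * Tsum (gC t) n (fun s : Multiset (Fin (n + 1)) => if Pk n s then 1 else 0) := by
  have h : Tsum (gC t) n (fun _ : Multiset (Fin (n + 1)) => (1 : R)) =
      ∑ k : Fin (n + 1), Tsum (gC t) n (fun s : Multiset (Fin (n + 1)) =>
        (fun s => if Pk n s then (1 : R) else 0) (s.map (Equiv.subRight k))) := by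
    unfold Tsum
    rw [← wsum_sum]
    apply wsum_congr
    intro l hl
    rw [← Finset.mul_sum]
    congr 1
    obtain ⟨k, hk, hu⟩ := cycle_lemma n (l : Multiset (Fin (n + 1))) (by simpa using hl)
    rw [Finset.sum_eq_single k]
    · simp only; rw [if_pos hk]
    · intro b _ hb
      simp only
      rw [if_neg fun h => hb (hu b h)]
    · simp
  rw [h]
  rw [Finset.sum_congr rfl fun k _ => Tsum_perm (gC t) (fC t) (by simp [gC]) (hfgC t)
    (Equiv.subRight k) n (fun s => if Pk n s then (1 : R) else 0)]
  simp

end Translate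

/-- the identity behind eq. (1.10)/(8.2) of
Linusson–Shareshian–Wachs: for `n ≥ 2`, the identity
`(n+1) ∑ t^{des w + 1} (1+t)^{n-2-2 des w}
  = (-1)^n (n+1) + ∑_{r=0}^{n-1} (-1)^r C(n+1,r) ∑_{k=0}^{n-1-r} C(n-1-r,k)
      ∑_{w ∈ [n+1]^{n-r-k}} t^{des w + k}`
holds in `ℤ[t]`, where the left sum is over all parking functions `w` of length `n` with
no double descent satisfying `w₁ ≤ w₂` and `w_{n-1} ≤ w_n`. -/
theorem statement_15 (n : ℕ) (hn : 2 ≤ n) :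
    ((n : Polynomial ℤ) + 1) *
        ∑ w ∈ (pfFinset n).filter
            (fun w => NDDF w ∧ w ⟨0, by omega⟩ ≤ w ⟨1, by omega⟩ ∧
              w ⟨n - 2, by omega⟩ ≤ w ⟨n - 1, by omega⟩),
          (X : Polynomial ℤ) ^ (desF w + 1) * (X + 1) ^ (n - 2 - 2 * desF w) =
      (-1 : Polynomial ℤ) ^ n * ((n : Polynomial ℤ) + 1) +
        ∑ r ∈ Finset.range n, (-1 : Polynomial ℤ) ^ r * ((n + 1).choose r : Polynomial ℤ) *
          ∑ k ∈ Finset.range (n - r), ((n - 1 - r).choose k : Polynomial ℤ) *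
            ∑ w ∈ Fintype.piFinset (fun _ : Fin (n - r - k) => Finset.Icc 1 (n + 1)),
              (X : Polynomial ℤ) ^ (desF w + k) := by

  have hL : ∑ w ∈ (pfFinset n).filter
            (fun w => NDDF w ∧ w ⟨0, by omega⟩ ≤ w ⟨1, by omega⟩ ∧
              w ⟨n - 2, by omega⟩ ≤ w ⟨n - 1, by omega⟩),
          (X : Polynomial ℤ) ^ (desF w + 1) * (X + 1) ^ (n - 2 - 2 * desF w) =
      Tsum (gC (X : ℤ[X])) n (fun s : Multiset (Fin (n + 1)) => if Pk n s then 1 else 0) := by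
    rw [Finset.sum_filter, Finset.sum_congr rfl fun w _ => (rwt_gC_word (X : ℤ[X]) n hn w (by omega) (by omega) (by omega) (by omega)).symm,
      sum_pf, Tsum, wsum_eq]
    refine Finset.sum_congr rfl fun w _ => ?_
    rw [rwt_ofFn_val]
  rw [hL, ← Tsum_parking]
  have hA : ∀ i, Tsum (gA (X : ℤ[X])) (i + 1) (fun _ : Multiset (Fin (n + 1)) => (1 : ℤ[X])) =
      X * ∑ w ∈ Fintype.piFinset (fun _ : Fin (i + 1) => Finset.Icc 1 (n + 1)), X ^ desF w := by
    intro i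
    rw [sum_icc_words, Tsum, wsum_eq, Finset.mul_sum]
    refine Finset.sum_congr rfl fun w _ => ?_
    rw [mul_one, ← rwt_ofFn_val, rwt_gA_word, pow_succ']
  have hX1 : (X : ℤ[X]) - 1 ≠ 0 := by
    intro h
    have := congrArg (Polynomial.eval 0) h
    simp at this
  have hS := series_main (X : ℤ[X]) Polynomial.X_ne_zero hX1 n
    (fun i => ∑ w ∈ Fintype.piFinset (fun _ : Fin i => Finset.Icc 1 (n + 1)), X ^ desF w) hA
  have hc := congrArg (PowerSeries.coeff n) hS
  rw [PowerSeries.coeff_mk] at hc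
  rw [hc, PowerSeries.coeff_mul, Finset.Nat.sum_antidiagonal_eq_sum_range_succ_mk,
    Finset.sum_range_succ, add_comm]
  have hp : ∀ r, PowerSeries.coeff r ((1 - (PowerSeries.X : PowerSeries ℤ[X])) ^ (n + 1)) =
      (-1) ^ r * ((n + 1).choose r : ℤ[X]) := by
    intro r
    exact coeff_one_sub_pow (n + 1) r
  simp only [hp, PowerSeries.coeff_mk]
  congr 1
  · simp
  · refine Finset.sum_congr rfl fun r hr => ?_
    rw [Finset.mem_range] at hr
    rw [if_neg (by omega)]
    congr 1
    refine Finset.sum_congr rfl fun k hk => ?_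
    rw [show n - r - 1 = n - 1 - r by omega, Finset.mul_sum]
    congr 1
    refine Finset.sum_congr rfl fun w _ => ?_
    rw [pow_add, mul_comm]
end

section
/- For every n ≥ 2, (n+2)² times the sum of 2^{n−2−2·des(w)}, taken over all parking functions w of length n that have no double descent and satisfy w₁ ≤ w₂ and w_{n−1} ≤ w_n, equals (n+1)^{n+1} + (−1)^n(n+3). -/
attribute [local instance] Classical.propDecidable

open Polynomial

/-- weight of a word, one letter at a time -/
noncomputable def wtV {α : Type*} [LinearOrder α] : List α → ℤ
  | [] => 1
  | [_] => 0
  | [a, b] => if a ≤ b then 1 else 0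
  | a :: b :: c :: l =>
      if a ≤ b then (if b ≤ c then 2 * wtV (b :: c :: l) else wtV (c :: l)) else 0

noncomputable def wtU {α : Type*} [LinearOrder α] (w : List α) : ℤ :=
  ∑ m ∈ Finset.range w.length,
    if (w.take (m + 1)).IsChain (· ≤ ·) then wtV (w.drop (m + 1)) else 0

noncomputable def wtS {α : Type*} [LinearOrder α] (w : List α) : ℤ :=
  ∑ m ∈ Finset.range w.length,
    if (w.take (m + 1)).IsChain (· ≤ ·) then (m : ℤ) * wtV (w.drop (m + 1)) else 0

section
variable {α : Type*} [LinearOrder α]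

theorem wtU_single (a : α) : wtU [a] = 1 := by simp [wtU, wtV]
theorem wtS_single (a : α) : wtS [a] = 0 := by simp [wtS]

theorem wtU_gt (a b : α) (l : List α) (h : b < a) : wtU (a :: b :: l) = wtV (b :: l) := by
  unfold wtU
  rw [List.length_cons, Finset.sum_range_succ']
  simp [List.isChain_cons_cons, not_le.mpr h]

theorem wtS_gt (a b : α) (l : List α) (h : b < a) : wtS (a :: b :: l) = 0 := by
  unfold wtS
  rw [List.length_cons, Finset.sum_range_succ']
  simp [List.isChain_cons_cons, not_le.mpr h]

theorem wtU_le (a b : α) (l : List α) (h : a ≤ b) :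
    wtU (a :: b :: l) = wtV (b :: l) + wtU (b :: l) := by
  unfold wtU
  rw [List.length_cons, Finset.sum_range_succ']
  rw [add_comm]
  simp [List.isChain_cons_cons, h]

theorem wtS_le (a b : α) (l : List α) (h : a ≤ b) :
    wtS (a :: b :: l) = wtS (b :: l) + wtU (b :: l) := by
  unfold wtU wtS
  rw [List.length_cons, Finset.sum_range_succ', ← Finset.sum_add_distrib]
  simp only [Nat.cast_zero, zero_mul, ite_self, add_zero]
  refine Finset.sum_congr rfl fun m _ => ?_
  simp only [List.take_succ_cons, List.isChain_cons_cons, h, true_and, List.drop_succ_cons]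
  split_ifs
  · push_cast; ring
  · simp

theorem wtU_eq_wtV (l : List α) : ∀ (a b : α), a ≤ b → wtU (a :: b :: l) = wtV (a :: b :: l) := by
  induction l with
  | nil => intro a b h; rw [wtU_le _ _ _ h, wtU_single]; simp [wtV, h]
  | cons c l ih =>
    intro a b h
    rw [wtU_le _ _ _ h]
    by_cases hbc : b ≤ c
    · rw [ih b c hbc, wtV]; simp [h, hbc]; ring
    · rw [wtU_gt _ _ _ (not_le.mp hbc)]
      have : wtV (b :: c :: l) = 0 := by
        cases l <;> simp [wtV, hbc]
      rw [this, wtV]; simp [h, hbc]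

theorem wtS_eq_wtV (l : List α) : ∀ (a : α), wtS (a :: l) = wtV (a :: l) := by
  induction l with
  | nil => intro a; rw [wtS_single]; simp [wtV]
  | cons b l ih =>
    intro a
    by_cases h : a ≤ b
    · rw [wtS_le _ _ _ h, ih, ← wtU_eq_wtV _ _ _ h, wtU_le _ _ _ h]
    · rw [wtS_gt _ _ _ (not_le.mp h)]
      cases l <;> simp [wtV, h]

theorem wtV_rec (w : List α) (hw : w ≠ []) : wtV w = ∑ m ∈ Finset.range w.length,
    if (w.take (m + 1)).IsChain (· ≤ ·) then (m : ℤ) * wtV (w.drop (m + 1)) else 0 := by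
  cases w with
  | nil => simp at hw
  | cons a l => rw [← wtS_eq_wtV]; rfl

theorem wtV_map {β : Type*} [LinearOrder β] (f : α → β) (hf : StrictMono f) (l : List α) :
    wtV (l.map f) = wtV l := by
  induction l using wtV.induct with
  | case1 => simp [wtV]
  | case2 => simp [wtV]
  | case3 a b h => simp [wtV, hf.le_iff_le]
  | case4 a b h => simp [wtV, hf.le_iff_le]
  | case5 a b c l h1 h2 ih => simp_all [wtV, hf.le_iff_le]
  | case6 a b c l h1 h2 ih =>
    rw [List.map_cons] at ih
    simp [wtV, hf.le_iff_le, h1, h2, ih, -not_le]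
  | case7 a b c l h1 => simp [wtV, hf.le_iff_le, h1, -not_le]
end

/-! ### sums over words -/

theorem sum_sorted (k m : ℕ) (g : Multiset (Fin k) → ℤ) :
    (∑ a : Fin m → Fin k, if (List.ofFn a).IsChain (· ≤ ·) then g (List.ofFn a) else 0) =
      ∑ M : Sym (Fin k) m, g M := by
  rw [← Finset.sum_filter]
  refine Finset.sum_bij' (fun a _ => (⟨(List.ofFn a : Multiset (Fin k)), by simp⟩ : Sym (Fin k) m))
    (fun M _ i => ((M : Multiset (Fin k)).sort (· ≤ ·))[(i : ℕ)]'(by simp)) ?_ ?_ ?_ ?_ ?_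
  · exact fun _ _ => Finset.mem_univ _
  · intro M _
    simp only [Finset.mem_filter, Finset.mem_univ, true_and]
    have : List.ofFn (fun i : Fin m => ((M : Multiset (Fin k)).sort (· ≤ ·))[(i : ℕ)]'(by simp))
      = (M : Multiset (Fin k)).sort (· ≤ ·) := by
      apply List.ext_getElem <;> simp
    rw [this, List.isChain_iff_pairwise]
    exact Multiset.pairwise_sort _ _
  · intro a ha
    simp only [Finset.mem_filter, Finset.mem_univ, true_and, List.isChain_iff_pairwise] at ha
    have : (Multiset.sort (List.ofFn a : Multiset (Fin k)) (· ≤ ·)) = List.ofFn a := by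
      rw [Multiset.coe_sort]
      exact List.mergeSort_eq_self _ (by simpa using ha)
    funext i
    simp [this]
  · intro M _
    ext1
    simp only [Sym.coe_mk]
    have : List.ofFn (fun i : Fin m => ((M : Multiset (Fin k)).sort (· ≤ ·))[(i : ℕ)]'(by simp))
      = (M : Multiset (Fin k)).sort (· ≤ ·) := by
      apply List.ext_getElem <;> simp
    rw [this, Multiset.sort_eq]
  · simp

noncomputable def wA (k n : ℕ) (f : Multiset (Fin k) → ℤ) : ℤ :=
  ∑ v : Fin n → Fin k, f (List.ofFn v) * wtV (List.ofFn v)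

theorem wA_zero (k : ℕ) (f : Multiset (Fin k) → ℤ) : wA k 0 f = f 0 := by
  simp [wA, wtV]

theorem wA_rec (k n : ℕ) (hn : n ≠ 0) (f : Multiset (Fin k) → ℤ) :
    wA k n f = ∑ m ∈ Finset.range n, (m : ℤ) * ∑ M : Sym (Fin k) (m + 1),
      wA k (n - (m + 1)) (fun N => f (M + N)) := by
  have h1 : wA k n f = ∑ v : Fin n → Fin k, ∑ m ∈ Finset.range n,
      f (List.ofFn v) * (if ((List.ofFn v).take (m + 1)).IsChain (· ≤ ·) then
        (m : ℤ) * wtV ((List.ofFn v).drop (m + 1)) else 0) := by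
    unfold wA
    refine Finset.sum_congr rfl fun v _ => ?_
    rw [wtV_rec _ (by simpa using hn), List.length_ofFn, Finset.mul_sum]
    refine Finset.sum_congr rfl fun m _ => ?_
    congr!
  rw [h1, Finset.sum_comm]
  refine Finset.sum_congr rfl fun m hm => ?_
  obtain ⟨r, rfl⟩ : ∃ r, n = (m + 1) + r := ⟨n - (m + 1), by have := Finset.mem_range.mp hm; omega⟩
  rw [← sum_sorted k (m + 1) (fun M => wA k (m + 1 + r - (m + 1)) (fun N => f (M + N)))]
  rw [Nat.add_sub_cancel_left, ← (Fin.appendEquiv (α := Fin k) (m + 1) r).sum_comp, Fintype.sum_prod_type,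
    Finset.mul_sum]
  refine Finset.sum_congr rfl fun a _ => ?_
  unfold wA
  simp only [Fin.appendEquiv, Equiv.coe_fn_mk, List.ofFn_fin_append]
  have e1 : ∀ b : Fin r → Fin k, (List.ofFn a ++ List.ofFn b).take (m + 1) = List.ofFn a :=
    fun b => List.take_left' (by simp)
  have e2 : ∀ b : Fin r → Fin k, (List.ofFn a ++ List.ofFn b).drop (m + 1) = List.ofFn b :=
    fun b => List.drop_left' (by simp)
  simp only [e1, e2]
  split_ifs
  · rw [Finset.mul_sum]
    refine Finset.sum_congr rfl fun b _ => ?_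
    rw [Multiset.coe_add]; ring
  · simp

theorem wA_perm (k : ℕ) (σ : Equiv.Perm (Fin k)) : ∀ (n : ℕ) (f : Multiset (Fin k) → ℤ),
    wA k n (fun N => f (N.map σ)) = wA k n f := by
  intro n
  induction n using Nat.strong_induction_on with
  | _ n ih =>
    intro f
    rcases eq_or_ne n 0 with rfl | hn
    · simp [wA_zero]
    · rw [wA_rec k n hn, wA_rec k n hn]
      refine Finset.sum_congr rfl fun m hm => ?_
      congr 1
      rw [← (Sym.equivCongr (n := m + 1) σ).sum_comp
        (fun M : Sym (Fin k) (m + 1) => wA k (n - (m + 1)) (fun N => f (M + N)))]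
      refine Finset.sum_congr rfl fun M _ => ?_
      have := ih (n - (m + 1)) (by omega) (fun N => f (Multiset.map σ (M : Multiset (Fin k)) + N))
      simpa [Sym.equivCongr, Sym.coe_map] using this

theorem wA_one_rec (k n : ℕ) (hn : n ≠ 0) :
    wA k n (fun _ => 1) = ∑ m ∈ Finset.range n, (m : ℤ) * ((k.multichoose (m + 1) : ℤ) *
      wA k (n - (m + 1)) (fun _ => 1)) := by
  rw [wA_rec k n hn]
  refine Finset.sum_congr rfl fun m hm => ?_
  simp [Sym.card_sym_eq_multichoose]

/-! ### the power series computation -/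

noncomputable def hS (k : ℕ) : PowerSeries ℤ := PowerSeries.mk fun m => (k.multichoose m : ℤ)

theorem hS_succ (k : ℕ) : (1 - PowerSeries.X) * hS (k + 1) = hS k := by
  ext m
  rw [sub_mul, one_mul]
  cases m with
  | zero => simp [hS]
  | succ m =>
    rw [map_sub, PowerSeries.coeff_succ_X_mul]
    simp [hS, Nat.multichoose_succ_succ]

theorem hS_mul (k : ℕ) : (1 - PowerSeries.X) ^ k * hS k = 1 := by
  induction k with
  | zero =>
    ext m
    cases m <;> simp [hS, PowerSeries.coeff_one]
  | succ k ih => rw [pow_succ, mul_assoc, hS_succ, ih]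

theorem hS_deriv (k : ℕ) :
    (1 - PowerSeries.X) ^ (k + 1) * PowerSeries.derivative ℤ (hS k) = (k : PowerSeries ℤ) := by
  have h := congrArg (PowerSeries.derivative ℤ) (hS_mul k)
  rw [Derivation.leibniz, Derivation.leibniz_pow] at h
  simp only [map_sub, Derivation.map_one_eq_zero, PowerSeries.derivative_X, smul_eq_mul, nsmul_eq_mul] at h
  cases k with
  | zero => 
    simp at h
    simp [h]
  | succ k =>
    have h2 := hS_mul (k + 1)
    simp only [Nat.add_sub_cancel] at h
    linear_combination (1 - PowerSeries.X) * h + ((k + 1 : ℕ) : PowerSeries ℤ) * h2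

noncomputable def tS (k : ℕ) : PowerSeries ℤ := PowerSeries.mk fun n => wA k n (fun _ => 1)

theorem tS_mul (k : ℕ) :
    tS k * (hS k - PowerSeries.X * PowerSeries.derivative ℤ (hS k)) = 1 := by
  have hc : ∀ m, PowerSeries.coeff m (hS k - PowerSeries.X * PowerSeries.derivative ℤ (hS k))
      = (1 - (m : ℤ)) * (k.multichoose m : ℤ) := by
    intro m
    cases m with
    | zero => simp [hS]
    | succ m =>
      rw [map_sub, PowerSeries.coeff_succ_X_mul, PowerSeries.coeff_derivative]
      simp [hS]; ring
  ext n
  rw [mul_comm, PowerSeries.coeff_mul, Finset.Nat.sum_antidiagonal_eq_sum_range_succ_mk]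
  simp only [hc]
  simp only [tS, PowerSeries.coeff_mk, PowerSeries.coeff_one]
  rw [Finset.sum_range_succ']
  rcases eq_or_ne n 0 with rfl | hn
  · simp [wA_zero]
  · simp only [hn, if_false, Nat.cast_zero, sub_zero, Nat.multichoose_zero_right, Nat.cast_one, one_mul]
    rw [Nat.sub_zero, wA_one_rec k n hn, ← Finset.sum_add_distrib]
    refine Finset.sum_eq_zero fun m _ => ?_
    push_cast; ring

theorem tS_eq (k : ℕ) :
    tS k * (1 - ((k + 1 : ℕ) : PowerSeries ℤ) * PowerSeries.X) = (1 - PowerSeries.X) ^ (k + 1) := by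
  have h1 := tS_mul k
  have h2 := hS_mul k
  have h3 := hS_deriv k
  push_cast
  linear_combination (1 - PowerSeries.X) ^ (k + 1) * h1 - tS k * (1 - PowerSeries.X) * h2 + 
    tS k * PowerSeries.X * h3

theorem coeff_one_sub_X_pow (c n : ℕ) :
    PowerSeries.coeff n ((1 - PowerSeries.X : PowerSeries ℤ) ^ c) = (-1) ^ n * (c.choose n : ℤ) := by
  have e : ((1 - PowerSeries.X : PowerSeries ℤ) ^ c) =
      (((1 - Polynomial.X : Polynomial ℤ) ^ c : Polynomial ℤ) : PowerSeries ℤ) := by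
    push_cast; rfl
  rw [e, Polynomial.coeff_coe]
  have e2 : (1 - Polynomial.X : Polynomial ℤ) ^ c
     = ((1 + Polynomial.X : Polynomial ℤ) ^ c).comp (Polynomial.C (-1) * Polynomial.X) := by
    simp [sub_eq_add_neg]
  rw [e2, Polynomial.comp_C_mul_X_coeff, Polynomial.coeff_one_add_X_pow, mul_comm]

theorem wA_succ (k n : ℕ) : wA k (n + 1) (fun _ => 1) = ((k : ℤ) + 1) * wA k n (fun _ => 1) +
    (-1) ^ (n + 1) * ((k + 1).choose (n + 1) : ℤ) := by
  have h := congrArg (PowerSeries.coeff (n + 1)) (tS_eq k)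
  rw [coeff_one_sub_X_pow] at h
  rw [← h]
  have : tS k * (1 - ((k + 1 : ℕ) : PowerSeries ℤ) * PowerSeries.X) =
    tS k - PowerSeries.X * (((k + 1 : ℕ)  : PowerSeries ℤ) * tS k) := by ring
  rw [this, map_sub, PowerSeries.coeff_succ_X_mul, ← nsmul_eq_mul, map_nsmul]
  simp [tS]

theorem wA_sum (k n : ℕ) : wA k n (fun _ => 1) =
    ∑ j ∈ Finset.range (n + 1), (-1) ^ j * ((k + 1).choose j : ℤ) * ((k : ℤ) + 1) ^ (n - j) := by
  induction n with
  | zero => simp [wA_zero]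
  | succ n ih =>
    rw [wA_succ, Finset.sum_range_succ, ih, Finset.mul_sum]
    congr 1
    · refine Finset.sum_congr rfl fun j hj => ?_
      have := Finset.mem_range.mp hj
      rw [show n + 1 - j = (n - j) + 1 by omega, pow_succ]; ring
    · simp

theorem wA_final (n : ℕ) : ((n : ℤ) + 2) ^ 2 * wA (n + 1) n (fun _ => 1) =
    ((n : ℤ) + 1) * (((n : ℤ) + 1) ^ (n + 1) + (-1) ^ n * ((n : ℤ) + 3)) := by
  have h2 : wA (n + 1) (n + 2) (fun _ => 1) = ((n : ℤ) + 1) ^ (n + 2) := by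
    have := add_pow (-1 : ℤ) ((n : ℤ) + 2) (n + 2)
    rw [wA_sum]
    rw [show ((n : ℤ) + 1) = -1 + (n + 2) by ring, this]
    refine Finset.sum_congr rfl fun j _ => ?_
    push_cast
    ring
  have h1 := wA_succ (n + 1) (n + 1)
  have h0 := wA_succ (n + 1) n
  rw [h2, h0] at h1
  have c1 : (n + 1 + 1).choose (n + 1) = n + 2 := by
    rw [Nat.choose_succ_self_right]
  rw [c1, Nat.choose_self] at h1
  push_cast at h1
  linear_combination -h1

/-! ### the cycle lemma -/

theorem cycle_aux_s17 (n : ℕ) (P : ℕ → ℤ) (hP : ∀ t, P (t + (n + 1)) = P t - 1) :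
    ∃! s : Fin (n + 1), ∀ i ≤ n, P s ≤ P (s + i) := by
  obtain ⟨s, -, hs⟩ := Finset.exists_min_image (Finset.univ : Finset (Fin (n + 1)))
    (fun t => ((n : ℤ) + 2) * P t + (t : ℕ)) ⟨0, Finset.mem_univ _⟩
  have hs' : ∀ j, j < n + 1 → ((n : ℤ) + 2) * P s + (s : ℕ) ≤ ((n : ℤ) + 2) * P j + (j : ℕ) :=
    fun j hj => hs ⟨j, hj⟩ (Finset.mem_univ _)
  have hs1 : ∀ j, j < n + 1 → P s ≤ P j := by
    intro j hj
    by_contra hlt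
    have h1 : P j + 1 ≤ P s := by omega
    have h2 := hs' j hj
    have h3 : ((n : ℤ) + 2) * (P j + 1) ≤ ((n : ℤ) + 2) * P s :=
      mul_le_mul_of_nonneg_left h1 (by positivity)
    rw [mul_add] at h3
    have := s.2
    omega
  have hs2 : ∀ j, j < (s : ℕ) → P s + 1 ≤ P j := by
    intro j hj
    have h0 := hs1 j (by have := s.2; omega)
    rcases h0.lt_or_eq with h | h
    · omega
    · have h2 := hs' j (by have := s.2; omega)
      rw [h] at h2
      omega
  refine ⟨s, ?_, ?_⟩
  · intro i hi
    by_cases h : (s : ℕ) + i < n + 1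
    · exact hs1 _ h
    · have h3 := hs2 ((s : ℕ) + i - (n + 1)) (by have := s.2; omega)
      have h4 := hP ((s : ℕ) + i - (n + 1))
      rw [Nat.sub_add_cancel (by omega)] at h4
      omega
  · intro t ht
    have key : ∀ a b : Fin (n + 1), (∀ i ≤ n, P a ≤ P (a + i)) → (∀ i ≤ n, P b ≤ P (b + i)) →
        (a : ℕ) < b → False := by
      intro a b ha hb hab
      have h1 := ha ((b : ℕ) - a) (by have := b.2; omega)
      have h2 := hb ((a : ℕ) + (n + 1) - b) (by omega)
      rw [show (a : ℕ) + ((b : ℕ) - a) = b by omega] at h1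
      rw [show (b : ℕ) + ((a : ℕ) + (n + 1) - b) = a + (n + 1) by have := b.2; omega, hP] at h2
      omega
    have hsg : ∀ i ≤ n, P s ≤ P (s + i) := by
      intro i hi
      by_cases h : (s : ℕ) + i < n + 1
      · exact hs1 _ h
      · have h3 := hs2 ((s : ℕ) + i - (n + 1)) (by have := s.2; omega)
        have h4 := hP ((s : ℕ) + i - (n + 1))
        rw [Nat.sub_add_cancel (by omega)] at h4
        omega
    rcases lt_trichotomy (t : ℕ) s with h | h | h
    · exact (key t s ht hsg h).elim
    · exact Fin.ext h
    · exact (key s t hsg ht h).elim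

def ParkM (n : ℕ) (M : Multiset (Fin (n + 1))) : Prop :=
  ∀ i ≤ n, i ≤ M.countP (fun x : Fin (n + 1) => (x : ℕ) < i)

theorem countP_shift (n : ℕ) (s : Fin (n + 1)) (i : ℕ) (hi : i ≤ n + 1)
    (M : Multiset (Fin (n + 1))) :
    M.countP (fun x => ((x - s : Fin (n + 1)) : ℕ) < i) =
      ∑ u ∈ Finset.range i, M.count (Fin.ofNat (n + 1) (s + u)) := by
  induction M using Multiset.induction with
  | empty => simp
  | cons x M ih =>
    simp only [Multiset.countP_cons, Multiset.count_cons, Finset.sum_add_distrib, ih]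
    congr 1
    have h : ∀ u ∈ Finset.range i, (if Fin.ofNat (n + 1) (s + u) = x then 1 else 0) =
        (if ((x - s : Fin (n + 1)) : ℕ) = u then 1 else 0) := by
      intro u hu
      have hu' := Finset.mem_range.mp hu
      have e : Fin.ofNat (n + 1) (s + u) = s + Fin.ofNat (n + 1) u := by
        apply Fin.ext
        simp [Fin.val_add]
      have : Fin.ofNat (n + 1) (s + u) = x ↔ ((x - s : Fin (n + 1)) : ℕ) = u := by
        rw [e, ← eq_sub_iff_add_eq', Fin.ext_iff]
        simp only [Fin.val_ofNat]
        rw [Nat.mod_eq_of_lt (by omega)]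
        exact eq_comm
      simp only [this]
    rw [Finset.sum_congr rfl h, Finset.sum_ite_eq]
    simp

theorem park_unique (n : ℕ) (M : Multiset (Fin (n + 1))) (hM : M.card = n) :
    ∃! s : Fin (n + 1), ParkM n (M.map (Equiv.subRight s)) := by
  set a : ℕ → ℕ := fun t => M.count (Fin.ofNat (n + 1) t) with ha
  have hper : ∀ t, a ((n + 1) + t) = a t := by
    intro t
    simp only [ha]
    congr 1
    apply Fin.ext
    simp
  have htot : ∑ u ∈ Finset.range (n + 1), a u = n := by
    have := countP_shift n 0 (n + 1) le_rfl M
    simp only [Fin.val_zero, zero_add] at this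
    rw [← this]
    refine Eq.trans ?_ hM
    rw [Multiset.countP_eq_card]
    intro x _
    exact (x - 0).2
  let P : ℕ → ℤ := fun t => (∑ u ∈ Finset.range t, (a u : ℤ)) - t
  have hP : ∀ t, P (t + (n + 1)) = P t - 1 := by
    intro t
    simp only [P]
    rw [add_comm t (n + 1), Finset.sum_range_add]
    simp only [hper]
    have : (∑ u ∈ Finset.range (n + 1), (a u : ℤ)) = n := by exact_mod_cast htot
    rw [this]; push_cast; ring
  have heq : ∀ s : Fin (n + 1), ParkM n (M.map (Equiv.subRight s)) ↔ ∀ i ≤ n, P s ≤ P (s + i) := by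
    intro s
    unfold ParkM
    refine forall₂_congr fun i hi => ?_
    have h1 : (M.map (Equiv.subRight s)).countP (fun x : Fin (n + 1) => (x : ℕ) < i)
        = ∑ u ∈ Finset.range i, a (s + u) := by
      rw [Multiset.countP_map, ← Multiset.countP_eq_card_filter, ← countP_shift n s i (by omega)]
      rfl
    rw [h1]
    simp only [P]
    rw [Finset.sum_range_add]
    have : ((∑ u ∈ Finset.range i, a (s + u) : ℕ) : ℤ) = ∑ u ∈ Finset.range i, (a (s + u) : ℤ) := by
      push_cast; rfl
    rw [← this]
    push_cast
    rw [← Nat.cast_le (α := ℤ)]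
    push_cast
    constructor <;> intro h <;> linarith
  simp only [heq]
  exact cycle_aux_s17 n P hP

theorem park_sum (n : ℕ) (M : Multiset (Fin (n + 1))) (hM : M.card = n) :
    ∑ s : Fin (n + 1), (if ParkM n (M.map (Equiv.subRight s)) then (1 : ℤ) else 0) = 1 := by
  obtain ⟨s, hs, hu⟩ := park_unique n M hM
  rw [Finset.sum_eq_single s]
  · rw [if_pos hs]
  · intro t _ hts
    rw [if_neg]
    exact fun h => hts (hu t h)
  · simp

theorem wA_park (n : ℕ) : ((n : ℤ) + 1) * wA (n + 1) n (fun M => if ParkM n M then 1 else 0) =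
    wA (n + 1) n (fun _ => 1) := by
  have h1 : ((n : ℤ) + 1) * wA (n + 1) n (fun M => if ParkM n M then 1 else 0) =
      ∑ s : Fin (n + 1), wA (n + 1) n
        (fun M => if ParkM n (M.map (Equiv.subRight s)) then 1 else 0) := by
    have : ∀ s : Fin (n + 1), wA (n + 1) n
        (fun M => if ParkM n (M.map (Equiv.subRight s)) then 1 else 0) =
        wA (n + 1) n (fun M => if ParkM n M then 1 else 0) := fun s =>
      wA_perm (n + 1) (Equiv.subRight s) n (fun M => if ParkM n M then 1 else 0)
    simp only [this]
    simp
  rw [h1]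
  unfold wA
  rw [Finset.sum_comm]
  refine Finset.sum_congr rfl fun v _ => ?_
  rw [← Finset.sum_mul, park_sum n _ (by simp)]

theorem isParkingFn_iff {n : ℕ} (w : Fin n → ℕ) : IsParkingFn w ↔
    (∀ i, 1 ≤ w i) ∧ ∀ i ≤ n, i ≤ (Finset.univ.filter fun j => w j ≤ i).card := by
  unfold IsParkingFn
  refine and_congr_right fun _ => ⟨?_, ?_⟩
  · rintro ⟨σ, -, h⟩ i hi
    calc i = (Finset.univ : Finset (Fin i)).card := by simp
      _ ≤ _ := Finset.card_le_card_of_injOn (fun x => σ (Fin.castLE hi x)) ?_ ?_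
    · intro x _
      have := h (Fin.castLE hi x)
      have hx := x.2
      simp only [Fin.val_castLE] at this
      simp only [Finset.coe_filter, Finset.mem_univ, true_and, Set.mem_ofPred_eq]
      omega
    · intro x _ y _ hxy
      exact Fin.castLE_injective hi (σ.injective hxy)
  · intro h
    refine ⟨Tuple.sort w, Tuple.monotone_sort w, fun i => ?_⟩
    by_contra hlt
    have h1 := h ((i : ℕ) + 1) i.2
    have h2 : (Finset.univ.filter fun j => w j ≤ (i : ℕ) + 1).card ≤ (Finset.range (i : ℕ)).card := by
      refine Finset.card_le_card_of_injOn (fun j => (((Tuple.sort w).symm j : Fin n) : ℕ)) ?_ ?_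
      · intro j hj
        simp only [Finset.coe_filter, Finset.mem_univ, true_and, Set.mem_ofPred_eq] at hj
        simp only [Finset.coe_range, Set.mem_Iio]
        by_contra hge
        have := Tuple.monotone_sort w (a := i) (b := (Tuple.sort w).symm j) (by
          rw [Fin.le_def]; omega)
        simp only [Function.comp, Equiv.apply_symm_apply] at this
        omega
      · intro x _ y _ hxy
        exact (Tuple.sort w).symm.injective (Fin.ext hxy)
    rw [Finset.card_range] at h2
    omega

theorem parkM_ofFn {n : ℕ} (v : Fin n → Fin (n + 1)) :
    ParkM n (List.ofFn v : Multiset (Fin (n + 1))) ↔ IsParkingFn (fun i => (v i : ℕ) + 1) := by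
  rw [isParkingFn_iff]
  unfold ParkM
  simp only [Nat.le_add_left, implies_true, true_and]
  refine forall₂_congr fun i hi => ?_
  have : (List.ofFn v : Multiset (Fin (n + 1))) = Multiset.map v Finset.univ.val := by
    simp [Fin.univ_val_map]
  rw [this, Multiset.countP_map]
  rfl

theorem pf_sum (n : ℕ) : ∑ w ∈ pfFinset n, wtV (List.ofFn w) =
    wA (n + 1) n (fun M => if ParkM n M then 1 else 0) := by
  unfold wA
  simp only [ite_mul, one_mul, zero_mul]
  rw [← Finset.sum_filter]
  symm
  refine Finset.sum_bij' (fun v _ i => (v i : ℕ) + 1) (fun w _ i => Fin.ofNat (n + 1) (w i - 1))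
    ?_ ?_ ?_ ?_ ?_
  · intro v hv
    simp only [Finset.mem_filter, Finset.mem_univ, true_and, parkM_ofFn] at hv
    simp only [pfFinset, Finset.mem_filter, Fintype.mem_piFinset, Finset.mem_Icc]
    refine ⟨fun i => ⟨by omega, ?_⟩, hv⟩
    obtain ⟨-, σ, -, h⟩ := hv
    have h1 := h (σ.symm i)
    rw [Equiv.apply_symm_apply] at h1
    beta_reduce at h1
    have := (σ.symm i).2
    omega
  · intro w hw
    simp only [pfFinset, Finset.mem_filter, Fintype.mem_piFinset, Finset.mem_Icc] at hw
    simp only [Finset.mem_filter, Finset.mem_univ, true_and, parkM_ofFn]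
    convert hw.2 using 2 with i
    have := hw.1 i
    simp only [Fin.val_ofNat]
    rw [Nat.mod_eq_of_lt (by omega)]
    omega
  · intro v _
    funext i
    apply Fin.ext
    simp
  · intro w hw
    simp only [pfFinset, Finset.mem_filter, Fintype.mem_piFinset, Finset.mem_Icc] at hw
    funext i
    have := hw.1 i
    simp only [Fin.val_ofNat]
    rw [Nat.mod_eq_of_lt (by omega)]
    omega
  · intro v _
    rw [← wtV_map (fun x : Fin (n + 1) => (x : ℕ) + 1) (fun a b h => by simpa using h), List.map_ofFn]
    rfl

/-! ### the closed form of the weight -/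

theorem desF_succ {m : ℕ} (w : Fin (m + 2) → ℕ) :
    desF w = (if w 1 < w 0 then 1 else 0) + desF (fun i : Fin (m + 1) => w i.succ) := by
  unfold desF
  simp only [Finset.card_filter]
  exact Fin.sum_univ_succ (n := m) (fun i : Fin (m + 1) => if w i.succ < w i.castSucc then 1 else 0)

theorem NDDF_succ {m : ℕ} (w : Fin (m + 3) → ℕ) :
    NDDF w ↔ ¬ (w 1 < w 0 ∧ w 2 < w 1) ∧ NDDF (fun i : Fin (m + 2) => w i.succ) := by
  constructor
  · intro h
    exact ⟨h 0 (by omega), fun i hi => h (i + 1) (by omega)⟩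
  · rintro ⟨h0, h⟩ i hi
    cases i with
    | zero => exact h0
    | succ i => exact h i (by omega)

def GoodF {m : ℕ} (w : Fin (m + 2) → ℕ) : Prop :=
  NDDF w ∧ w ⟨0, by omega⟩ ≤ w ⟨1, by omega⟩ ∧ w ⟨m, by omega⟩ ≤ w ⟨m + 1, by omega⟩

theorem good_case1 {m : ℕ} (w : Fin (m + 3) → ℕ) (h0 : w 0 ≤ w 1) (h1 : w 1 ≤ w 2) :
    GoodF w ↔ GoodF (fun i : Fin (m + 2) => w i.succ) := by
  unfold GoodF
  rw [NDDF_succ]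
  have e0 : w ⟨0, by omega⟩ ≤ w ⟨1, by omega⟩ := h0
  have e1 : w (Fin.succ ⟨0, by omega⟩) ≤ w (Fin.succ ⟨1, by omega⟩) := h1
  simp only [e0, e1, not_lt.mpr h0, false_and, not_false_iff, true_and]
  rfl

theorem good_case2 {m : ℕ} (w : Fin (m + 4) → ℕ) (h0 : w 0 ≤ w 1) (h1 : w 2 < w 1) :
    GoodF w ↔ GoodF (fun i : Fin (m + 2) => w i.succ.succ) := by
  unfold GoodF
  rw [NDDF_succ, NDDF_succ]
  have e0 : w ⟨0, by omega⟩ ≤ w ⟨1, by omega⟩ := h0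
  have e1 : w (Fin.succ 1) < w (Fin.succ 0) := h1
  have e2 : (w (Fin.succ 2) < w (Fin.succ 1)) ↔ ¬ w (Fin.succ (Fin.succ ⟨0, by omega⟩)) ≤ w (Fin.succ (Fin.succ ⟨1, by omega⟩)) := by
    rw [not_le]; rfl
  simp only [e0, e1, e2, not_lt.mpr h0, false_and, not_false_iff, true_and, not_not]
  constructor
  · rintro ⟨⟨a, b⟩, c⟩; exact ⟨b, a, c⟩
  · rintro ⟨b, a, c⟩; exact ⟨⟨a, b⟩, c⟩

theorem closed_form : ∀ (m : ℕ) (w : Fin (m + 2) → ℕ), (GoodF w → 2 * desF w ≤ m) ∧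
    wtV (List.ofFn w) = if GoodF w then (2 : ℤ) ^ (m - 2 * desF w) else 0 := by
  intro m
  induction m using Nat.strong_induction_on with
  | _ m ih =>
  intro w
  match m, ih, w with
  | 0, ih, w =>
    have hd : desF w = if w 1 < w 0 then 1 else 0 := by
      rw [desF_succ]; simp [desF]
    have hg : GoodF w ↔ w 0 ≤ w 1 := by
      refine ⟨fun h => h.2.1, fun h => ⟨fun i hi => by omega, h, h⟩⟩
    have hV : wtV (List.ofFn w) = if w 0 ≤ w 1 then 1 else 0 := by
      simp [List.ofFn_succ, wtV]
    rw [hV, hd]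
    by_cases h : w 0 ≤ w 1
    · simp [hg, h]
    · simp [hg, h]
  | m + 1, ih, w =>
    have hV : wtV (List.ofFn w) = if w 0 ≤ w 1 then (if w 1 ≤ w 2 then
        2 * wtV (List.ofFn fun i : Fin (m + 2) => w i.succ) else
          wtV (List.ofFn fun i : Fin (m + 1) => w i.succ.succ)) else 0 := by
      simp only [List.ofFn_succ, wtV]
      congr!
    rw [hV]
    by_cases h0 : w 0 ≤ w 1
    · by_cases h1 : w 1 ≤ w 2
      · obtain ⟨ih1, ih2⟩ := ih m (by omega) (fun i : Fin (m + 2) => w i.succ)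
        have hd : desF w = desF (fun i : Fin (m + 2) => w i.succ) :=
          (desF_succ w).trans (by rw [if_neg (not_lt.mpr h0), zero_add])
        rw [ih2, good_case1 w h0 h1, hd]
        generalize desF (fun i : Fin (m + 2) => w i.succ) = d at *
        simp only [h0, h1, if_true]
        refine ⟨fun h => by have := ih1 h; omega, ?_⟩
        split_ifs with hg
        · have := ih1 hg
          rw [show m + 1 - 2 * d = (m - 2 * d) + 1 by omega, pow_succ]
          ring
        · simp
      · have h1' := not_le.mp h1
        match m, ih, w with
        | 0, ih, w =>
          have hng : ¬ GoodF w := fun h => h1 h.2.2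
          simp [hng, h0, h1, wtV, List.ofFn_succ, -not_le]
        | m + 1, ih, w =>
          obtain ⟨ih1, ih2⟩ := ih m (by omega) (fun i : Fin (m + 2) => w i.succ.succ)
          have e1 : w (Fin.succ 1) < w (Fin.succ 0) := h1'
          have hd : desF w = 1 + desF (fun i : Fin (m + 2) => w i.succ.succ) :=
            (desF_succ w).trans (by
              rw [if_neg (not_lt.mpr h0), zero_add]
              exact (desF_succ (fun i : Fin (m + 3) => w i.succ)).trans (by rw [if_pos e1]))
          rw [ih2, good_case2 w h0 h1', hd]
          generalize desF (fun i : Fin (m + 2) => w i.succ.succ) = d at *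
          simp only [h0, h1, if_true, if_false]
          refine ⟨fun h => by have := ih1 h; omega, ?_⟩
          split_ifs with hg
          · congr 1; omega
          · rfl
    · have hng : ¬ GoodF w := fun h => h0 h.2.1
      simp [hng, h0, -not_le]

/-- Corollary 8.2 of Linusson–Shareshian–Wachs, the `t = 1` case:
for `n ≥ 2`, `(n+2)²` times the sum of `2^{n-2-2 des w}` over all parking functions `w`
of length `n` with no double descent satisfying `w₁ ≤ w₂` and `w_{n-1} ≤ w_n` equals
`(n+1)^{n+1} + (-1)^n (n+3)`. -/
theorem statement_17 (n : ℕ) (hn : 2 ≤ n) :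
    ((n : ℤ) + 2) ^ 2 *
        ∑ w ∈ (pfFinset n).filter
            (fun w => NDDF w ∧ w ⟨0, by omega⟩ ≤ w ⟨1, by omega⟩ ∧
              w ⟨n - 2, by omega⟩ ≤ w ⟨n - 1, by omega⟩),
          (2 : ℤ) ^ (n - 2 - 2 * desF w) =
      ((n : ℤ) + 1) ^ (n + 1) + (-1) ^ n * ((n : ℤ) + 3) := by
  have key : ∑ w ∈ (pfFinset n).filter
            (fun w => NDDF w ∧ w ⟨0, by omega⟩ ≤ w ⟨1, by omega⟩ ∧
              w ⟨n - 2, by omega⟩ ≤ w ⟨n - 1, by omega⟩),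
          (2 : ℤ) ^ (n - 2 - 2 * desF w) = ∑ w ∈ pfFinset n, wtV (List.ofFn w) := by
    obtain ⟨m, rfl⟩ : ∃ m, n = m + 2 := ⟨n - 2, by omega⟩
    rw [Finset.sum_filter]
    refine Finset.sum_congr rfl fun w _ => ?_
    rw [(closed_form m w).2]
    exact if_congr Iff.rfl rfl rfl
  rw [key, pf_sum]
  have h1 := wA_park n
  have h2 := wA_final n
  have h3 : ((n : ℤ) + 1) ≠ 0 := by positivity
  apply mul_left_cancel₀ h3
  rw [← h2, ← h1]
  ring
end
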